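/- Let a > 0 and let n ≥ 2 be an integer; set m = a·n and α = a·(n−1). Let f be the unique density solution to the equation x^{an} f(x) = (1/Γ(a(n−1))) ∫_0^x (x−v)^{a(n−1)−1} f(v) dv on (0,∞). Then for every s > −a, the Mellin transform satisfies ∫_0^∞ x^{−s} f(x) dx = ∏_{i=1}^{n−1} Γ(ia + s) / Γ(ia). (Equivalently, f is the density of ( Γ_a × Γ_{2a} × ⋯ × Γ_{a(n−1)} )^{−1} for independent Gamma random variables.) -/

import Mathlib

open MeasureTheory Real Set Filter

noncomputable section

/-- `f` is a density solution to the integro-differential equation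
`I^α_{0+} f = x^m f` on `(0,∞)`: `f` is measurable, nonnegative on `(0,∞)`,
integrates to `1` on `(0,∞)`, and satisfies
`x^m f(x) = (1/Γ(α)) ∫_0^x (x−v)^{α−1} f(v) dv` for every `x > 0`. -/
def IsDensitySolution (α m : ℝ) (f : ℝ → ℝ) : Prop :=
  Measurable f ∧ (∀ x ∈ Set.Ioi (0:ℝ), 0 ≤ f x) ∧
  (∫ x in Set.Ioi (0:ℝ), f x) = 1 ∧
  ∀ x ∈ Set.Ioi (0:ℝ),
    x ^ m * f x = (1 / Real.Gamma α) * ∫ v in Set.Ioo (0:ℝ) x, (x - v) ^ (α - 1) * f v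

lemma setLIntegral_Ioo_rpow_mul_one_sub_rpow {s α : ℝ} (hs : 0 < s) (hα : 0 < α) :
    ∫⁻ t in Ioo (0 : ℝ) 1, ENNReal.ofReal (t ^ (s - 1) * (1 - t) ^ (α - 1)) =
      ENNReal.ofReal (ProbabilityTheory.beta s α) := by
  have hB := ProbabilityTheory.beta_pos hs hα
  have h := ProbabilityTheory.lintegral_betaPDF_eq_one hs hα
  rw [ProbabilityTheory.lintegral_betaPDF] at h
  simp_rw [mul_assoc, ENNReal.ofReal_mul (one_div_pos.2 hB).le] at h
  rw [lintegral_const_mul' _ _ ENNReal.ofReal_ne_top] at h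
  calc _ = ENNReal.ofReal (ProbabilityTheory.beta s α) *
        (ENNReal.ofReal (1 / ProbabilityTheory.beta s α) *
          ∫⁻ t in Ioo (0 : ℝ) 1, ENNReal.ofReal (t ^ (s - 1) * (1 - t) ^ (α - 1))) := by
        rw [← mul_assoc, ← ENNReal.ofReal_mul hB.le, mul_one_div_cancel hB.ne',
          ENNReal.ofReal_one, one_mul]
    _ = _ := by rw [h, mul_one]

lemma image_div_Ioo_zero_one {v : ℝ} (hv : 0 < v) : (fun t => v / t) '' Ioo 0 1 = Ioi v := by
  ext x
  constructor
  · rintro ⟨t, ⟨h0, h1⟩, rfl⟩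
    exact (lt_div_iff₀ h0).2 (by nlinarith)
  · intro hx
    have hx0 : 0 < x := hv.trans hx
    exact ⟨v / x, ⟨by positivity, (div_lt_one hx0).2 hx⟩, by field_simp⟩

lemma setLIntegral_Ioi_rpow_mul_sub_rpow {v s α : ℝ} (hv : 0 < v) (hs : 0 < s) (hα : 0 < α) :
    ∫⁻ x in Ioi v, ENNReal.ofReal (x ^ (-(s + α)) * (x - v) ^ (α - 1)) =
      ENNReal.ofReal (v ^ (-s)) * ENNReal.ofReal (ProbabilityTheory.beta s α) := by
  rw [← image_div_Ioo_zero_one hv, lintegral_image_eq_lintegral_abs_deriv_mul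
    (f' := fun t => -v / t ^ 2) measurableSet_Ioo, ← setLIntegral_Ioo_rpow_mul_one_sub_rpow hs hα,
    ← lintegral_const_mul' _ _ ENNReal.ofReal_ne_top]
  · refine setLIntegral_congr_fun measurableSet_Ioo fun t ht => ?_
    obtain ⟨h0, h1⟩ := ht
    have h1' : 0 < 1 - t := sub_pos.2 h1
    have e : v / t - v = v * (1 - t) / t := by field_simp
    have habs : |-v / t ^ 2| = v * t ^ (-2 : ℝ) := by
      rw [abs_div, abs_neg, abs_of_pos hv, abs_of_pos (by positivity), rpow_neg h0.le,
        ← div_eq_mul_inv]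
      norm_cast
    rw [← ENNReal.ofReal_mul (abs_nonneg _), ← ENNReal.ofReal_mul (by positivity), habs, e,
      div_rpow hv.le h0.le, div_rpow (by positivity) h0.le, mul_rpow hv.le h1'.le]
    congr 1
    calc _ = (v ^ (1 : ℝ) * v ^ (-(s + α)) * v ^ (α - 1)) *
          (t ^ (-2 : ℝ) * (t ^ (-(s + α)))⁻¹ * (t ^ (α - 1))⁻¹) * (1 - t) ^ (α - 1) := by
          rw [rpow_one]; ring
      _ = _ := by
          rw [← rpow_neg h0.le, ← rpow_neg h0.le, ← rpow_add hv, ← rpow_add hv, ← rpow_add h0,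
            ← rpow_add h0, ← mul_assoc]
          ring_nf
  · intro t ht
    have h : HasDerivAt (fun t => v / t) (-v / t ^ 2) t := by
      simpa using (hasDerivAt_const t v).fun_div (hasDerivAt_id t) ht.1.ne'
    exact h.hasDerivWithinAt
  · intro x hx y hy hxy
    exact inv_injective (mul_left_cancel₀ hv.ne' (by simpa only [div_eq_mul_inv] using hxy))

lemma ae_integrableOn_sub_rpow_mul {f : ℝ → ℝ} (hf : IntegrableOn f (Ioi 0)) {α : ℝ}
    (hα : 0 < α) :
    ∀ᵐ x : ℝ, IntegrableOn (fun v => (x - v) ^ (α - 1) * f v) (Ioo 0 x) := by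
  have h1 : Integrable ((Ioi (0 : ℝ)).indicator fun v => exp (-v) * f v) := by
    refine IntegrableOn.integrable_indicator ?_ measurableSet_Ioi
    refine Integrable.bdd_mul (c := 1) hf (by fun_prop) ?_
    filter_upwards [ae_restrict_mem measurableSet_Ioi] with v hv
    simpa using (mem_Ioi.1 hv).le
  have h2 : Integrable ((Ioi (0 : ℝ)).indicator fun t => exp (-t) * t ^ (α - 1)) :=
    (GammaIntegral_convergent hα).integrable_indicator measurableSet_Ioi
  filter_upwards [h1.ae_convolution_exists (ContinuousLinearMap.mul ℝ ℝ) h2] with x hx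
  have h3 : IntegrableOn _ (Ioo 0 x) := (Integrable.const_mul hx (exp x)).integrableOn
  refine h3.congr_fun (fun v hv => ?_) measurableSet_Ioo
  have hv1 : v ∈ Ioi (0 : ℝ) := hv.1
  have hv2 : x - v ∈ Ioi (0 : ℝ) := sub_pos.2 hv.2
  simp only [ContinuousLinearMap.mul_apply', indicator_of_mem hv1, indicator_of_mem hv2]
  calc _ = (exp x * (exp (-v) * exp (-(x - v)))) * ((x - v) ^ (α - 1) * f v) := by ring
    _ = _ := by rw [← exp_add, ← exp_add, show x + (-v + -(x - v)) = 0 by ring, exp_zero, one_mul]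

/-- The Mellin transform `s ↦ ∫ x ^ (-s) f(x) dx` over `(0,∞)`, with values in `[0,∞]`. -/
def lmellin (f : ℝ → ℝ) (s : ℝ) : ENNReal :=
  ∫⁻ x in Ioi (0 : ℝ), ENNReal.ofReal (x ^ (-s) * f x)

namespace IsDensitySolution

variable {α m a : ℝ} {f : ℝ → ℝ}

lemma integrableOn (hf : IsDensitySolution α m f) : IntegrableOn f (Ioi 0) := by
  by_contra h
  simpa [integral_undef h] using hf.2.2.1

lemma ae_ofReal_eq (hf : IsDensitySolution α m f) (hα : 0 < α) :
    ∀ᵐ x : ℝ ∂volume.restrict (Ioi 0), ENNReal.ofReal (x ^ m * f x) =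
      ENNReal.ofReal (1 / Real.Gamma α) *
        ∫⁻ v in Ioo 0 x, ENNReal.ofReal ((x - v) ^ (α - 1) * f v) := by
  filter_upwards [ae_restrict_of_ae (ae_integrableOn_sub_rpow_mul hf.integrableOn hα),
    ae_restrict_mem measurableSet_Ioi] with x hx hx0
  rw [hf.2.2.2 x hx0, ENNReal.ofReal_mul (one_div_pos.2 (Gamma_pos_of_pos hα)).le,
    ofReal_integral_eq_lintegral_ofReal hx]
  filter_upwards [ae_restrict_mem measurableSet_Ioo] with v hv
  exact mul_nonneg (rpow_nonneg (sub_pos.2 hv.2).le _) (hf.2.1 v hv.1)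

lemma lmellin_eq (hf : IsDensitySolution α m f) (hα : 0 < α) {s : ℝ} (hs : 0 < s) :
    lmellin f (s + α - m) =
      ENNReal.ofReal (Real.Gamma s / Real.Gamma (s + α)) * lmellin f s := by
  have hΓ := Gamma_pos_of_pos hα
  have hfm := hf.1
  calc lmellin f (s + α - m)
      = ∫⁻ x in Ioi (0 : ℝ), ENNReal.ofReal (x ^ (-(s + α))) * ENNReal.ofReal (x ^ m * f x) := by
        refine setLIntegral_congr_fun measurableSet_Ioi fun x hx => ?_
        have hx0 : 0 < x := hx
        rw [← ENNReal.ofReal_mul (rpow_nonneg hx0.le _), ← mul_assoc, ← rpow_add hx0]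
        ring_nf
    _ = ∫⁻ x in Ioi (0 : ℝ), ENNReal.ofReal (1 / Real.Gamma α) *
          ∫⁻ v in Ioi 0, (Ioi v).indicator
            (fun x => ENNReal.ofReal (x ^ (-(s + α)) * (x - v) ^ (α - 1)) *
              ENNReal.ofReal (f v)) x := by
        refine lintegral_congr_ae ?_
        filter_upwards [hf.ae_ofReal_eq hα, ae_restrict_mem measurableSet_Ioi] with x hx hx0
        have hx0' : 0 < x := hx0
        rw [hx, mul_left_comm, ← lintegral_const_mul' _ _ ENNReal.ofReal_ne_top]
        congr 1
        rw [← lintegral_indicator measurableSet_Ioi, ← lintegral_indicator measurableSet_Ioo]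
        refine lintegral_congr fun v => ?_
        by_cases h0 : 0 < v <;> by_cases h1 : v < x <;> simp [h0, h1]
        rw [← ENNReal.ofReal_mul (by positivity), ← mul_assoc,
          ENNReal.ofReal_mul (mul_nonneg (by positivity) (rpow_nonneg (sub_pos.2 h1).le _))]
    _ = ENNReal.ofReal (1 / Real.Gamma α) * ∫⁻ v in Ioi (0 : ℝ), ∫⁻ x in Ioi (0 : ℝ),
          (Ioi v).indicator (fun x => ENNReal.ofReal (x ^ (-(s + α)) * (x - v) ^ (α - 1)) *
              ENNReal.ofReal (f v)) x := by
        rw [lintegral_const_mul' _ _ ENNReal.ofReal_ne_top, lintegral_lintegral_swap]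
        refine Measurable.aemeasurable ?_
        have hset : MeasurableSet {p : ℝ × ℝ | p.2 < p.1} :=
          measurableSet_lt measurable_snd measurable_fst
        have : Measurable fun p : ℝ × ℝ => ENNReal.ofReal (p.1 ^ (-(s + α)) *
            (p.1 - p.2) ^ (α - 1)) * ENNReal.ofReal (f p.2) := by fun_prop
        exact this.indicator hset
    _ = ENNReal.ofReal (1 / Real.Gamma α) * ∫⁻ v in Ioi (0 : ℝ),
          ENNReal.ofReal (ProbabilityTheory.beta s α) * ENNReal.ofReal (v ^ (-s) * f v) := by
        congr 1
        refine setLIntegral_congr_fun measurableSet_Ioi fun v hv => ?_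
        have hv0 : 0 < v := hv
        rw [setLIntegral_indicator measurableSet_Ioi, Ioi_inter_Ioi, sup_of_le_left hv0.le,
          lintegral_mul_const' _ _ ENNReal.ofReal_ne_top,
          setLIntegral_Ioi_rpow_mul_sub_rpow hv0 hs hα, ENNReal.ofReal_mul (by positivity)]
        ring
    _ = _ := by
        rw [lintegral_const_mul' _ _ ENNReal.ofReal_ne_top, ← mul_assoc,
          ← ENNReal.ofReal_mul (one_div_pos.2 hΓ).le, lmellin, ProbabilityTheory.beta]
        congr 2
        field_simp

lemma lmellin_zero (hf : IsDensitySolution α m f) : lmellin f 0 = 1 := by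
  have h := ofReal_integral_eq_lintegral_ofReal hf.integrableOn
    (by filter_upwards [ae_restrict_mem measurableSet_Ioi] with x hx using hf.2.1 x hx)
  rw [hf.2.2.1, ENNReal.ofReal_one] at h
  simp [lmellin, ← h]

lemma lmellin_ne_zero (hf : IsDensitySolution α m f) (s : ℝ) : lmellin f s ≠ 0 := by
  intro h
  have hfm := hf.1
  rw [lmellin, lintegral_eq_zero_iff (by fun_prop)] at h
  have h0 : f =ᵐ[volume.restrict (Ioi 0)] 0 := by
    filter_upwards [h, ae_restrict_mem measurableSet_Ioi] with x hx hx0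
    have hp := rpow_pos_of_pos (mem_Ioi.1 hx0) (-s)
    have : x ^ (-s) * f x ≤ 0 := by simpa using hx
    exact le_antisymm (nonpos_of_mul_nonpos_right this hp) (hf.2.1 x hx0)
  simpa [integral_congr_ae h0] using hf.2.2.1

lemma lmellin_convex (hf : IsDensitySolution α m f) (s t : ℝ) {p q : ℝ} (hp : 0 ≤ p)
    (hq : 0 ≤ q) (hpq : p + q = 1) :
    lmellin f (p * s + q * t) ≤ lmellin f s ^ p * lmellin f t ^ q := by
  have hfm := hf.1
  refine le_trans (le_of_eq ?_) (ENNReal.lintegral_mul_norm_pow_le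
    (by fun_prop) (by fun_prop) hp hq hpq)
  refine setLIntegral_congr_fun measurableSet_Ioi fun x hx => ?_
  have hx0 : 0 < x := hx
  have hfx := hf.2.1 x hx
  rw [ENNReal.ofReal_rpow_of_nonneg (by positivity) hp,
    ENNReal.ofReal_rpow_of_nonneg (by positivity) hq, ← ENNReal.ofReal_mul (by positivity),
    mul_rpow (by positivity) hfx, mul_rpow (by positivity) hfx, mul_mul_mul_comm,
    ← rpow_add_of_nonneg hfx hp hq, hpq, rpow_one, ← rpow_mul hx0.le, ← rpow_mul hx0.le,
    ← rpow_add hx0]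
  ring_nf

lemma lmellin_le_add (hf : IsDensitySolution α m f) {s t : ℝ} (hs : 0 ≤ s) (hst : s ≤ t) :
    lmellin f s ≤ lmellin f 0 + lmellin f t := by
  have hfm := hf.1
  rw [lmellin, lmellin, lmellin, ← lintegral_add_left (by fun_prop)]
  refine setLIntegral_mono' measurableSet_Ioi fun x hx => ?_
  have hx0 : 0 < x := hx
  have hfx := hf.2.1 x hx
  rw [← ENNReal.ofReal_add (by positivity) (by positivity), ← add_mul]
  refine ENNReal.ofReal_le_ofReal (mul_le_mul_of_nonneg_right ?_ hfx)
  rcases le_total x 1 with h | h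
  · have := rpow_le_rpow_of_exponent_ge hx0 h (neg_le_neg hst)
    have : 0 < x ^ (-0 : ℝ) := by positivity
    linarith
  · have := rpow_le_rpow_of_exponent_le h (show -s ≤ -0 by linarith)
    have : 0 < x ^ (-t) := by positivity
    linarith

lemma integral_eq_toReal (hf : IsDensitySolution α m f) (s : ℝ) :
    ∫ x in Ioi (0 : ℝ), x ^ (-s) * f x = (lmellin f s).toReal := by
  have hfm := hf.1
  refine integral_eq_lintegral_of_nonneg_ae ?_
    (Measurable.aestronglyMeasurable (by fun_prop))
  filter_upwards [ae_restrict_mem measurableSet_Ioi] with x hx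
  exact mul_nonneg (rpow_nonneg (mem_Ioi.1 hx).le _) (hf.2.1 x hx)

lemma lmellin_eq_shift (hf : IsDensitySolution α (α + a) f) (hα : 0 < α) {s : ℝ}
    (hs : -a < s) :
    lmellin f s =
      ENNReal.ofReal (Real.Gamma (s + a) / Real.Gamma (s + a + α)) * lmellin f (s + a) := by
  rw [← hf.lmellin_eq hα (by linarith)]
  congr 1
  ring

lemma lmellin_ne_top (hf : IsDensitySolution α (α + a) f) (hα : 0 < α) (ha : 0 < a) {s : ℝ}
    (hs : -a < s) : lmellin f s ≠ ⊤ := by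
  have hnat : ∀ k : ℕ, lmellin f (k * a) ≠ ⊤ := by
    intro k
    induction k with
    | zero => simp [hf.lmellin_zero]
    | succ k ih =>
      intro htop
      have hk : (0 : ℝ) ≤ k * a := by positivity
      have hΓ : 0 < Real.Gamma (k * a + a) / Real.Gamma (k * a + a + α) :=
        div_pos (Gamma_pos_of_pos (by linarith)) (Gamma_pos_of_pos (by linarith))
      rw [Nat.cast_succ, add_one_mul] at htop
      rw [hf.lmellin_eq_shift hα (by linarith), htop,
        ENNReal.mul_top (ENNReal.ofReal_pos.2 hΓ).ne'] at ih
      exact ih rfl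
  have hnonneg : ∀ t, 0 ≤ t → lmellin f t ≠ ⊤ := by
    intro t ht
    obtain ⟨k, hk⟩ := exists_nat_ge (t / a)
    refine ne_top_of_le_ne_top (ENNReal.add_ne_top.2 ⟨?_, hnat k⟩)
      (hf.lmellin_le_add ht ((div_le_iff₀ ha).1 hk))
    simp [hf.lmellin_zero]
  rw [hf.lmellin_eq_shift hα hs]
  exact ENNReal.mul_ne_top ENNReal.ofReal_ne_top (hnonneg _ (by linarith))

lemma toReal_lmellin_pos (hf : IsDensitySolution α (α + a) f) (hα : 0 < α) (ha : 0 < a) {s : ℝ}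
    (hs : -a < s) : 0 < (lmellin f s).toReal :=
  ENNReal.toReal_pos (hf.lmellin_ne_zero s) (hf.lmellin_ne_top hα ha hs)

lemma log_lmellin_add (hf : IsDensitySolution α (α + a) f) (hα : 0 < α) (ha : 0 < a) {s : ℝ}
    (hs : -a < s) :
    log (lmellin f (s + a)).toReal = log (lmellin f s).toReal +
      (log (Real.Gamma (s + a + α)) - log (Real.Gamma (s + a))) := by
  have h1 : 0 < Real.Gamma (s + a) := Gamma_pos_of_pos (by linarith)
  have h2 : 0 < Real.Gamma (s + a + α) := Gamma_pos_of_pos (by linarith)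
  rw [hf.lmellin_eq_shift hα hs, ENNReal.toReal_mul, ENNReal.toReal_ofReal (by positivity),
    log_mul (by positivity) (hf.toReal_lmellin_pos hα ha (by linarith)).ne',
    log_div h1.ne' h2.ne']
  ring

lemma convexOn_log_lmellin (hf : IsDensitySolution α (α + a) f) (hα : 0 < α) (ha : 0 < a) :
    ConvexOn ℝ (Ioi (-a)) fun s => log (lmellin f s).toReal := by
  refine ⟨convex_Ioi _, fun x hx y hy p q hp hq hpq => ?_⟩
  have hxy : p • x + q • y ∈ Ioi (-a) := convex_Ioi (-a) hx hy hp hq hpq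
  have hx' := hf.toReal_lmellin_pos hα ha hx
  have hy' := hf.toReal_lmellin_pos hα ha hy
  have h := ENNReal.toReal_mono (ENNReal.mul_ne_top
    (ENNReal.rpow_ne_top_of_nonneg hp (hf.lmellin_ne_top hα ha hx))
    (ENNReal.rpow_ne_top_of_nonneg hq (hf.lmellin_ne_top hα ha hy)))
    (hf.lmellin_convex x y hp hq hpq)
  rw [ENNReal.toReal_mul, ← ENNReal.toReal_rpow, ← ENNReal.toReal_rpow] at h
  have h' := log_le_log (hf.toReal_lmellin_pos hα ha hxy) h
  rwa [log_mul (by positivity) (by positivity), log_rpow hx', log_rpow hy'] at h'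

end IsDensitySolution

lemma ConvexOn.abs_sub_le_of_add_eq {g G h : ℝ → ℝ} {a s y : ℝ} (ha : 0 < a) (hs : 0 < s)
    (hy : 0 < y)
    (hg : ConvexOn ℝ (Ioi (-a)) g) (hG : ConvexOn ℝ (Ioi (-a)) G)
    (hgh : ∀ x, -a < x → g (x + a) = g x + h x) (hGh : ∀ x, -a < x → G (x + a) = G x + h x) :
    |(g (y + s) - g y) - (G (y + s) - G y)| ≤ s / a * (h (y + s) - h (y - a)) := by
  have key : ∀ {φ : ℝ → ℝ}, ConvexOn ℝ (Ioi (-a)) φ →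
      (∀ x, -a < x → φ (x + a) = φ x + h x) →
      s / a * h (y - a) ≤ φ (y + s) - φ y ∧ φ (y + s) - φ y ≤ s / a * h (y + s) := by
    intro φ hφ hφh
    have h1 := hφ.slope_mono_adjacent (x := y - a) (y := y) (z := y + s)
      (mem_Ioi.2 (by linarith)) (mem_Ioi.2 (by linarith)) (by linarith) (by linarith)
    have h2 := hφ.slope_mono_adjacent (x := y) (y := y + s) (z := y + s + a)
      (mem_Ioi.2 (by linarith)) (mem_Ioi.2 (by linarith)) (by linarith) (by linarith)
    have e1 := hφh (y - a) (by linarith)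
    rw [sub_add_cancel] at e1
    rw [e1, sub_sub_cancel, add_sub_cancel_left, add_sub_cancel_left, ← e1,
      div_le_div_iff₀ ha hs] at h1
    rw [hφh (y + s) (by linarith), add_sub_cancel_left, add_sub_cancel_left, add_sub_cancel_left,
      div_le_div_iff₀ hs ha] at h2
    rw [div_mul_eq_mul_div, div_mul_eq_mul_div, div_le_iff₀ ha, le_div_iff₀ ha]
    constructor <;> linarith
  have h1 := key hg hgh
  have h2 := key hG hGh
  rw [abs_le, mul_sub]
  constructor <;> linarith [h1.1, h1.2, h2.1, h2.2]

/-- The uniqueness theorem of Krull for convex solutions of a difference equation. -/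
lemma ConvexOn.eq_of_add_eq {g G h : ℝ → ℝ} {a : ℝ} (ha : 0 < a)
    (hg : ConvexOn ℝ (Ioi (-a)) g) (hG : ConvexOn ℝ (Ioi (-a)) G)
    (hgh : ∀ x, -a < x → g (x + a) = g x + h x) (hGh : ∀ x, -a < x → G (x + a) = G x + h x)
    (h0 : g 0 = G 0)
    (hlim : ∀ s, 0 < s → Tendsto (fun y => h (y + s) - h (y - a)) atTop (nhds 0)) :
    ∀ s, -a < s → g s = G s := by
  have hper : ∀ s, -a < s → ∀ k : ℕ, g (k * a + s) - G (k * a + s) = g s - G s := by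
    intro s hs k
    induction k with
    | zero => simp
    | succ k ih =>
      have hk0 : 0 ≤ k * a := by positivity
      have hk : -a < k * a + s := by linarith
      have e : ((k + 1 : ℕ) : ℝ) * a + s = k * a + s + a := by push_cast; ring
      rw [e, hgh _ hk, hGh _ hk, ← ih]
      ring
  have hpos : ∀ s, 0 < s → g s = G s := by
    intro s hs
    have htop : Tendsto (fun k : ℕ => (k : ℝ) * a) atTop atTop :=
      tendsto_natCast_atTop_atTop.atTop_mul_const ha
    have hl := ((hlim s hs).const_mul (s / a)).comp htop
    rw [mul_zero] at hl
    have : |g s - G s| ≤ 0 := by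
      refine ge_of_tendsto hl ?_
      filter_upwards [eventually_gt_atTop 0] with k hk
      have hb := ConvexOn.abs_sub_le_of_add_eq ha hs
        (show 0 < (k : ℝ) * a by positivity) hg hG hgh hGh
      have e1 := hper s (by linarith) k
      have e2 := hper 0 (by linarith) k
      rw [add_zero, h0, sub_self] at e2
      have e : (g (k * a + s) - g (k * a)) - (G (k * a + s) - G (k * a)) = g s - G s := by
        linarith
      rwa [e] at hb
    exact sub_eq_zero.1 (abs_nonpos_iff.1 this)
  intro s hs
  have := hpos (s + a) (by linarith)
  rw [hgh s hs, hGh s hs] at this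
  linarith

lemma log_Gamma_add_one {x : ℝ} (hx : 0 < x) :
    log (Real.Gamma (x + 1)) = log x + log (Real.Gamma x) := by
  rw [Gamma_add_one hx.ne', log_mul hx.ne' (Gamma_pos_of_pos hx).ne']

lemma log_Gamma_add_sub_le {x c : ℝ} (hx : 0 < x) (hc : 0 < c) :
    log (Real.Gamma (x + c)) - log (Real.Gamma x) ≤ c * log (x + c) := by
  have h := convexOn_log_Gamma.slope_mono_adjacent (x := x) (y := x + c) (z := x + c + 1)
    hx (mem_Ioi.2 (by linarith)) (by linarith) (by linarith)
  simp only [Function.comp_apply] at h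
  rw [log_Gamma_add_one (by linarith), add_sub_cancel_left, add_sub_cancel_left,
    add_sub_cancel_right, div_one, div_le_iff₀ hc] at h
  linarith

lemma le_log_Gamma_add_sub {x c : ℝ} (hx : 1 < x) (hc : 0 < c) :
    c * log (x - 1) ≤ log (Real.Gamma (x + c)) - log (Real.Gamma x) := by
  have h := convexOn_log_Gamma.slope_mono_adjacent (x := x - 1) (y := x) (z := x + c)
    (mem_Ioi.2 (by linarith)) (mem_Ioi.2 (by linarith)) (by linarith) (by linarith)
  simp only [Function.comp_apply] at h
  have e := log_Gamma_add_one (x := x - 1) (by linarith)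
  rw [sub_add_cancel] at e
  rw [add_sub_cancel_left, sub_sub_cancel, div_one, le_div_iff₀ hc, e, add_sub_cancel_right,
    ← e] at h
  linarith

lemma tendsto_log_add_sub_log_add (b c : ℝ) :
    Tendsto (fun y => log (y + b) - log (y + c)) atTop (nhds 0) := by
  have h : ∀ b : ℝ, Tendsto (fun y => log (y + b) - log y) atTop (nhds 0) :=
    Real.tendsto_log_comp_add_sub_log
  simpa using (h b).sub (h c)

lemma tendsto_log_Gamma_second_difference {a c s : ℝ} (ha : 0 < a) (hc : 0 < c) (hs : 0 < s) :
    Tendsto (fun y => (log (Real.Gamma (y + s + a + c)) - log (Real.Gamma (y + s + a))) -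
      (log (Real.Gamma (y - a + a + c)) - log (Real.Gamma (y - a + a)))) atTop (nhds 0) := by
  have hub := (tendsto_log_add_sub_log_add (s + a + c) (-1)).const_mul c
  have hlb := (tendsto_log_add_sub_log_add (s + a - 1) c).const_mul c
  rw [mul_zero] at hub hlb
  refine tendsto_of_tendsto_of_tendsto_of_le_of_le' hlb hub ?_ ?_ <;>
  filter_upwards [eventually_gt_atTop 1] with y hy
  all_goals
    have u1 := log_Gamma_add_sub_le (x := y + s + a) (by linarith) hc
    have u2 := log_Gamma_add_sub_le (x := y) (by linarith) hc
    have l1 := le_log_Gamma_add_sub (x := y + s + a) (by linarith) hc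
    have l2 := le_log_Gamma_add_sub hy hc
    rw [sub_add_cancel, mul_sub]
    ring_nf at u1 u2 l1 l2 ⊢
    linarith

/-- The logarithm of `∏_{i=1}^{N} Γ(ia+s)/Γ(ia)`. -/
def logGammaProd (a : ℝ) (N : ℕ) (s : ℝ) : ℝ :=
  ∑ i ∈ Finset.Icc 1 N, (log (Real.Gamma (i * a + s)) - log (Real.Gamma (i * a)))

lemma logGammaProd_zero (a : ℝ) (N : ℕ) : logGammaProd a N 0 = 0 := by simp [logGammaProd]

lemma logGammaProd_add (a s : ℝ) (N : ℕ) :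
    logGammaProd a N (s + a) = logGammaProd a N s +
      (log (Real.Gamma (s + a + N * a)) - log (Real.Gamma (s + a))) := by
  induction N with
  | zero => simp [logGammaProd]
  | succ N ih =>
    simp only [logGammaProd] at ih ⊢
    rw [Finset.sum_Icc_succ_top (by omega), Finset.sum_Icc_succ_top (by omega), ih]
    rw [show ((N + 1 : ℕ) : ℝ) * a + (s + a) = s + a + (N + 1 : ℕ) * a by ring,
      show ((N + 1 : ℕ) : ℝ) * a + s = s + a + N * a by push_cast; ring]
    ring

lemma mul_add_pos_of_mem_Icc {a s : ℝ} (ha : 0 < a) (hs : -a < s) {i N : ℕ}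
    (hi : i ∈ Finset.Icc 1 N) :
    0 < i * a + s := by
  have : (1 : ℝ) ≤ i := by exact_mod_cast (Finset.mem_Icc.1 hi).1
  nlinarith

lemma convexOn_logGammaProd {a : ℝ} (ha : 0 < a) (N : ℕ) :
    ConvexOn ℝ (Ioi (-a)) (logGammaProd a N) := by
  refine ⟨convex_Ioi _, fun x hx y hy p q hp hq hpq => ?_⟩
  simp only [logGammaProd, smul_eq_mul, Finset.mul_sum]
  rw [← Finset.sum_add_distrib]
  refine Finset.sum_le_sum fun i hi => ?_
  have h := convexOn_log_Gamma.2 (mul_add_pos_of_mem_Icc ha hx hi) (mul_add_pos_of_mem_Icc ha hy hi)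
    hp hq hpq
  simp only [Function.comp_apply, smul_eq_mul] at h
  have e : p * (i * a + x) + q * (i * a + y) = i * a + (p * x + q * y) := by
    linear_combination (i * a) * hpq
  rw [e] at h
  linear_combination h + log (Real.Gamma (i * a)) * hpq

lemma exp_logGammaProd {a s : ℝ} (ha : 0 < a) (hs : -a < s) (N : ℕ) :
    exp (logGammaProd a N s) =
      ∏ i ∈ Finset.Icc 1 N, Real.Gamma (i * a + s) / Real.Gamma (i * a) := by
  rw [logGammaProd, exp_sum]
  refine Finset.prod_congr rfl fun i hi => ?_
  have h0 := mul_add_pos_of_mem_Icc ha (show -a < 0 by linarith) hi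
  rw [add_zero] at h0
  rw [exp_sub, exp_log (Gamma_pos_of_pos (mul_add_pos_of_mem_Icc ha hs hi)),
    exp_log (Gamma_pos_of_pos h0)]

/-- For `m = an` and `α = a(n−1)` with `a > 0` and an integer `n ≥ 2`, the Mellin
transform of the density solution is `∏_{i=1}^{n−1} Γ(ia+s)/Γ(ia)` for `s > −a`. -/
theorem density_solution_m_an_mellin (a : ℝ) (ha : 0 < a) (n : ℕ) (hn : 2 ≤ n)
    (f : ℝ → ℝ)
    (hf : IsDensitySolution (a * ((n : ℝ) - 1)) (a * n) f) :
    ∀ s : ℝ, -a < s →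
      (∫ x in Set.Ioi (0:ℝ), x ^ (-s) * f x) =
        ∏ i ∈ Finset.Icc 1 (n - 1),
          Real.Gamma ((i : ℝ) * a + s) / Real.Gamma ((i : ℝ) * a) := by
  intro s hs
  obtain ⟨N, rfl⟩ : ∃ N, n = N + 1 := ⟨n - 1, by omega⟩
  have hN : (0 : ℝ) < N := by exact_mod_cast (show 0 < N by omega)
  have hα : 0 < N * a := by positivity
  have hf' : IsDensitySolution (N * a) (N * a + a) f := by
    convert hf using 1 <;> push_cast <;> ring
  have hlog := ConvexOn.eq_of_add_eq ha (hf'.convexOn_log_lmellin hα ha)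
    (convexOn_logGammaProd ha N) (fun x hx => hf'.log_lmellin_add hα ha hx)
    (fun x _ => logGammaProd_add a x N) (by simp [hf'.lmellin_zero, logGammaProd_zero])
    (fun t ht => tendsto_log_Gamma_second_difference ha hα ht) s hs
  rw [hf'.integral_eq_toReal, Nat.add_sub_cancel, ← exp_logGammaProd ha hs, ← hlog,
    exp_log (hf'.toReal_lmellin_pos hα ha hs)]
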